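/- arXiv:2306.08090 — 3 statements merged into one kernel-verified Lean document; each statement's English description precedes it below -/
import Mathlib

section
/- Let V : [0,∞) → ℝ be continuously differentiable with V(t) ≥ 0 for all t ≥ 0. Suppose there exist λ₁, λ₂ > 0 and α ∈ (0,1) such that V'(t) ≤ −λ₁·V(t) − λ₂·V(t)^α at every t ≥ 0 with V(t) > 0. Then V(t) = 0 for all t ≥ T₀, where T₀ := (1/(λ₁(1−α)))·ln((λ₁·V(0)^{1−α} + λ₂)/λ₂). -/
/-- A differentiable function on the half-line that stays nonnegative and has nonpositive derivative
wherever it is positive is antitone. -/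
theorem antitoneOn_Ici_of_deriv_nonpos_of_pos {V : ℝ → ℝ} (hV : Differentiable ℝ V) {a : ℝ}
    (hnn : ∀ t, a ≤ t → 0 ≤ V t) (hderiv : ∀ t, a ≤ t → 0 < V t → deriv V t ≤ 0) :
    AntitoneOn V (Set.Ici a) := by
  refine antitoneOn_of_deriv_nonpos (convex_Ici a) hV.continuous.continuousOn
    hV.differentiableOn fun t ht => ?_
  rw [interior_Ici, Set.mem_Ioi] at ht
  rcases (hnn t ht.le).eq_or_lt with h0 | hpos
  · have hmin : IsLocalMin V t := by
      filter_upwards [Ioi_mem_nhds ht] with s hs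
      rw [← h0]
      exact hnn s (le_of_lt hs)
    exact hmin.deriv_eq_zero.le
  · exact hderiv t ht.le hpos

/-- As long as `V` is positive, the inequality `V' ≤ -l₁ V - l₂ V ^ α` makes
`log (l₁ V ^ (1 - α) + l₂)` decrease at rate at least `l₁ (1 - α)`. -/
theorem log_rpow_add_le_of_deriv_le {V : ℝ → ℝ} (hV : Differentiable ℝ V) {l₁ l₂ α : ℝ}
    (hl₁ : 0 < l₁) (hl₂ : 0 < l₂) (hα : α < 1) {a b : ℝ} (hab : a ≤ b)
    (hpos : ∀ s ∈ Set.Icc a b, 0 < V s)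
    (hderiv : ∀ s ∈ Set.Icc a b, deriv V s ≤ -l₁ * V s - l₂ * V s ^ α) :
    Real.log (l₁ * V b ^ (1 - α) + l₂) + l₁ * (1 - α) * b ≤
      Real.log (l₁ * V a ^ (1 - α) + l₂) + l₁ * (1 - α) * a := by
  have hW : ∀ s ∈ Set.Icc a b,
      HasDerivAt (fun s => Real.log (l₁ * V s ^ (1 - α) + l₂) + l₁ * (1 - α) * s)
        (l₁ * (deriv V s * (1 - α) * V s ^ (1 - α - 1)) / (l₁ * V s ^ (1 - α) + l₂)
          + l₁ * (1 - α) * 1) s := fun s hs => by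
    have hs := hpos s hs
    have hne : l₁ * V s ^ (1 - α) + l₂ ≠ 0 := by positivity
    exact ((((hV s).hasDerivAt.rpow_const (Or.inl hs.ne')).const_mul l₁).add_const l₂
      |>.log hne).add ((hasDerivAt_id s).const_mul _)
  refine antitoneOn_of_deriv_nonpos (convex_Icc a b)
    (fun s hs => (hW s hs).continuousAt.continuousWithinAt)
    (fun s hs => (hW s (interior_subset hs)).differentiableAt.differentiableWithinAt)
    (fun s hs => ?_) (Set.left_mem_Icc.2 hab) (Set.right_mem_Icc.2 hab) hab
  have hs := interior_subset hs
  rw [(hW s hs).deriv]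
  have hVs := hpos s hs
  have hD : 0 < l₁ * V s ^ (1 - α) + l₂ := by positivity
  have hfactor : (l₁ * V s ^ (1 - α) + l₂) * V s ^ α = l₁ * V s + l₂ * V s ^ α := by
    rw [add_mul, mul_assoc, ← Real.rpow_add hVs, sub_add_cancel, Real.rpow_one]
  have hbound : deriv V s * V s ^ (-α) ≤ -(l₁ * V s ^ (1 - α) + l₂) := by
    rw [Real.rpow_neg hVs.le, ← div_eq_mul_inv, div_le_iff₀ (Real.rpow_pos_of_pos hVs α)]
    linarith [hderiv s hs]
  have hc : 0 < l₁ * (1 - α) := mul_pos hl₁ (sub_pos.2 hα)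
  rw [show 1 - α - 1 = -α by ring, mul_one, ← le_neg_iff_add_nonpos_right, div_le_iff₀ hD]
  linarith [mul_le_mul_of_nonneg_left hbound hc.le]

/-- scalar Lyapunov comparison form of fast finite-time stability (FFTS):
a nonnegative continuously differentiable function satisfying `V' ≤ -λ₁ V - λ₂ V^α`
(whenever `V > 0`) with `λ₁, λ₂ > 0`, `α ∈ (0,1)` reaches zero by the settling time
`T₀ = (1/(λ₁(1-α))) * log((λ₁ V(0)^(1-α) + λ₂)/λ₂)` and stays at zero. -/
theorem ffts_lyapunov (V : ℝ → ℝ) (hV : ContDiff ℝ 1 V)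
    (hnn : ∀ t : ℝ, 0 ≤ t → 0 ≤ V t)
    (lam1 lam2 α : ℝ) (hlam1 : 0 < lam1) (hlam2 : 0 < lam2)
    (hα : α ∈ Set.Ioo (0 : ℝ) 1)
    (hineq : ∀ t : ℝ, 0 ≤ t → 0 < V t →
      deriv V t ≤ -lam1 * V t - lam2 * V t ^ α) :
    ∀ t : ℝ,
      (1 / (lam1 * (1 - α))) * Real.log ((lam1 * V 0 ^ (1 - α) + lam2) / lam2) ≤ t →
      V t = 0 := by
  intro t ht
  have hd : Differentiable ℝ V := hV.differentiable one_ne_zero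
  have hc : 0 < lam1 * (1 - α) := mul_pos hlam1 (sub_pos.2 hα.2)
  have hV0 : 0 ≤ lam1 * V 0 ^ (1 - α) :=
    mul_nonneg hlam1.le (Real.rpow_nonneg (hnn 0 le_rfl) _)
  have ht0 : 0 ≤ t := by
    refine le_trans (mul_nonneg (by positivity) (Real.log_nonneg ?_)) ht
    rw [one_le_div hlam2]
    linarith
  by_contra hne
  have hVt : 0 < V t := (hnn t ht0).lt_of_ne' hne
  have hanti : AntitoneOn V (Set.Ici 0) :=
    antitoneOn_Ici_of_deriv_nonpos_of_pos hd hnn fun s hs hVs => by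
      have h₁ : 0 < lam1 * V s := by positivity
      have h₂ : 0 < lam2 * V s ^ α := by positivity
      linarith [hineq s hs hVs]
  have hpos : ∀ s ∈ Set.Icc 0 t, 0 < V s := fun s hs => hVt.trans_le (hanti hs.1 ht0 hs.2)
  have hlog := log_rpow_add_le_of_deriv_le hd hlam1 hlam2 hα.2 ht0 hpos
    fun s hs => hineq s hs.1 (hpos s hs)
  rw [Real.log_div (by linarith) hlam2.ne', one_div, inv_mul_le_iff₀ hc] at ht
  have hlt : Real.log lam2 < Real.log (lam1 * V t ^ (1 - α) + lam2) :=
    Real.log_lt_log hlam2 (lt_add_of_pos_left _ (by positivity))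
  linarith
end

section
/- Fix n ≥ 1, p ∈ (1,2) and k > 0. For all e, μ ∈ ℝⁿ, ‖φ₁ᵖᵏ(e+μ) − φ₁ᵖᵏ(e)‖ ≤ k·‖μ‖ + 2^{2(p−1)/(3p−2)}·‖μ‖^{p/(3p−2)}. -/
theorem Real.sq_rpow_sub_rpow_le {a b β : ℝ} (ha : 0 ≤ a) (hb : 0 ≤ b) (h0 : 0 < β) (h1 : β ≤ 1) :
    (a ^ β - b ^ β) ^ 2 ≤ ((a - b) ^ 2) ^ β := by
  wlog hab : b ≤ a generalizing a b
  · have := this hb ha (le_of_not_ge hab)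
    rwa [← neg_sub (a ^ β), ← neg_sub a, neg_sq, neg_sq] at this
  have hsub : 0 ≤ a - b := sub_nonneg.2 hab
  have h := Real.rpow_add_le_add_rpow hsub hb h0.le h1
  rw [sub_add_cancel] at h
  have hmono := Real.rpow_le_rpow hb hab h0.le
  rw [← Real.rpow_pow_comm hsub]
  exact pow_le_pow_left₀ (by linarith) (by linarith) 2

theorem Real.rpow_add_rpow_le_two_rpow_mul {a b β : ℝ} (ha : 0 ≤ a) (hb : 0 ≤ b) (h0 : 0 < β) (h1 : β ≤ 1) :
    a ^ β + b ^ β ≤ 2 ^ (1 - β) * (a + b) ^ β := by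
  have h := (Real.concaveOn_rpow h0.le h1).2 (Set.mem_Ici.2 ha) (Set.mem_Ici.2 hb)
    (show (0 : ℝ) ≤ 1 / 2 by norm_num) (show (0 : ℝ) ≤ 1 / 2 by norm_num) (by norm_num)
  simp only [smul_eq_mul] at h
  rw [← mul_add, ← mul_add, Real.mul_rpow (by norm_num) (by positivity),
    Real.div_rpow (by norm_num) (by norm_num), Real.one_rpow] at h
  rw [Real.rpow_sub (by norm_num), Real.rpow_one]
  linear_combination 2 * h

theorem norm_rpow_smul_sub_le {E : Type*} [NormedAddCommGroup E] [InnerProductSpace ℝ E]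
    {β : ℝ} (h0 : 0 < β) (h1 : β ≤ 1) (x y : E) :
    ‖‖x‖ ^ (β - 1) • x - ‖y‖ ^ (β - 1) • y‖ ≤ 2 ^ (1 - β) * ‖x - y‖ ^ β := by
  have hone : (1 : ℝ) ≤ 2 ^ (1 - β) := Real.one_le_rpow (by norm_num) (by linarith)
  have hmul : ∀ z : E, z ≠ 0 → ‖z‖ ^ (β - 1) * ‖z‖ = ‖z‖ ^ β := fun z hz => by
    rw [← Real.rpow_add_one (norm_ne_zero_iff.2 hz), sub_add_cancel]
  have hzero : ∀ z : E, ‖‖z‖ ^ (β - 1) • z‖ ≤ 2 ^ (1 - β) * ‖z‖ ^ β := fun z => by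
    rcases eq_or_ne z 0 with rfl | hz
    · simp only [smul_zero, norm_zero]; positivity
    · rw [norm_smul, Real.norm_of_nonneg (by positivity), hmul z hz]
      exact le_mul_of_one_le_left (by positivity) hone
  rcases eq_or_ne x 0 with rfl | hx
  · simpa using hzero y
  rcases eq_or_ne y 0 with rfl | hy
  · simpa using hzero x
  have ha : 0 < ‖x‖ := norm_pos_iff.2 hx
  have hb : 0 < ‖y‖ := norm_pos_iff.2 hy
  have hA := hmul x hx
  have hB := hmul y hy
  refine (sq_le_sq₀ (by positivity) (by positivity)).1 ?_
  obtain ⟨c, hc⟩ : ∃ c, c = inner ℝ x y / (‖x‖ * ‖y‖) := ⟨_, rfl⟩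
  have hinner : inner ℝ x y = c * (‖x‖ * ‖y‖) := by rw [hc]; field_simp
  have hc' : |c| ≤ 1 := hc ▸ abs_real_inner_div_norm_mul_norm_le_one x y
  obtain ⟨hc₁, hc₂⟩ := abs_le.1 hc'
  have hconc := (Real.concaveOn_rpow h0.le h1).2
    (Set.mem_Ici.2 (sq_nonneg (‖x‖ - ‖y‖))) (Set.mem_Ici.2 (sq_nonneg (‖x‖ + ‖y‖)))
    (show 0 ≤ (1 + c) / 2 by linarith) (show 0 ≤ (1 - c) / 2 by linarith) (by ring)
  simp only [smul_eq_mul] at hconc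
  have hnorm : (1 + c) / 2 * (‖x‖ - ‖y‖) ^ 2 + (1 - c) / 2 * (‖x‖ + ‖y‖) ^ 2 = ‖x - y‖ ^ 2 := by
    rw [norm_sub_sq_real, hinner]; ring
  rw [hnorm, ← Real.rpow_pow_comm (norm_nonneg _),
    ← Real.rpow_pow_comm (add_nonneg ha.le hb.le)] at hconc
  have hsub := Real.sq_rpow_sub_rpow_le ha.le hb.le h0 h1
  have hadd := pow_le_pow_left₀ (by positivity) (Real.rpow_add_rpow_le_two_rpow_mul ha.le hb.le h0 h1) 2
  have hlhs : ‖‖x‖ ^ (β - 1) • x - ‖y‖ ^ (β - 1) • y‖ ^ 2 =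
      (1 + c) / 2 * (‖x‖ ^ β - ‖y‖ ^ β) ^ 2 + (1 - c) / 2 * (‖x‖ ^ β + ‖y‖ ^ β) ^ 2 := by
    rw [norm_sub_sq_real, norm_smul, norm_smul, real_inner_smul_left, real_inner_smul_right,
      Real.norm_of_nonneg (by positivity), Real.norm_of_nonneg (by positivity), hinner, ← hA, ← hB]
    ring
  have hsub' : (‖x‖ ^ β - ‖y‖ ^ β) ^ 2 ≤ (2 ^ (1 - β)) ^ 2 * ((‖x‖ - ‖y‖) ^ 2) ^ β :=
    hsub.trans (le_mul_of_one_le_left (by positivity) (one_le_pow₀ hone))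
  rw [hlhs, mul_pow]
  rw [mul_pow] at hadd
  calc _ ≤ (1 + c) / 2 * ((2 ^ (1 - β)) ^ 2 * ((‖x‖ - ‖y‖) ^ 2) ^ β) +
        (1 - c) / 2 * ((2 ^ (1 - β)) ^ 2 * ((‖x‖ + ‖y‖) ^ β) ^ 2) :=
        add_le_add (mul_le_mul_of_nonneg_left hsub' (by linarith))
          (mul_le_mul_of_nonneg_left hadd (by linarith))
    _ = (2 ^ (1 - β)) ^ 2 * ((1 + c) / 2 * ((‖x‖ - ‖y‖) ^ 2) ^ β +
        (1 - c) / 2 * ((‖x‖ + ‖y‖) ^ β) ^ 2) := by ring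
    _ ≤ _ := mul_le_mul_of_nonneg_left hconc (by positivity)


/-- `φ₁ᵖᵏ(e) = k e + ‖e‖^(2(1-p)/(3p-2)) e` (value `0` at `e = 0`). -/
noncomputable def phi1 {n : ℕ} (p k : ℝ) (e : EuclideanSpace ℝ (Fin n)) :
    EuclideanSpace ℝ (Fin n) :=
  k • e + (‖e‖ ^ (2 * (1 - p) / (3 * p - 2))) • e

/-- noise robustness of the first stage of the HC-FFTSD:
`‖φ₁ᵖᵏ(e+μ) - φ₁ᵖᵏ(e)‖ ≤ k ‖μ‖ + 2^(2(p-1)/(3p-2)) ‖μ‖^(p/(3p-2))`. -/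
theorem phi1_noise_bound (n : ℕ) (hn : 1 ≤ n) (p k : ℝ)
    (hp : p ∈ Set.Ioo (1 : ℝ) 2) (hk : 0 < k)
    (e μ : EuclideanSpace ℝ (Fin n)) :
    ‖phi1 p k (e + μ) - phi1 p k e‖ ≤
      k * ‖μ‖ + 2 ^ (2 * (p - 1) / (3 * p - 2)) * ‖μ‖ ^ (p / (3 * p - 2)) := by
  obtain ⟨hp₁, -⟩ := hp
  have hd : 0 < 3 * p - 2 := by linarith
  have h0 : 0 < p / (3 * p - 2) := div_pos (by linarith) hd
  have h1 : p / (3 * p - 2) ≤ 1 := (div_le_one hd).2 (by linarith)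
  have hexp : 2 * (1 - p) / (3 * p - 2) = p / (3 * p - 2) - 1 := by
    rw [div_sub_one hd.ne']; ring
  have hexp' : 2 * (p - 1) / (3 * p - 2) = 1 - p / (3 * p - 2) := by
    rw [one_sub_div hd.ne']; ring
  have h := norm_rpow_smul_sub_le h0 h1 (e + μ) e
  rw [add_sub_cancel_left] at h
  have hsplit : phi1 p k (e + μ) - phi1 p k e = k • μ +
      (‖e + μ‖ ^ (p / (3 * p - 2) - 1) • (e + μ) - ‖e‖ ^ (p / (3 * p - 2) - 1) • e) := by
    rw [phi1, phi1, hexp, smul_add k e μ]; abel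
  rw [hsplit, hexp']
  refine (norm_add_le _ _).trans (add_le_add ?_ h)
  rw [norm_smul, Real.norm_of_nonneg hk.le]
end

section
/- Fix m > 0, p ∈ (1,2), observer gains k_{t1}, k_{t2}, k_{t3} > 0 and κ_t > 1/2, and controller gains κ_T, k_{TD}, k_{TP} > 0 together with a diagonal matrix L_T = diag(L_{T1},L_{T2},L_{T3}) with all L_{Ti} > 0. Let A_t = [[−k_{t1}, 1],[−k_{t2}, 0]], let Q_t be a symmetric positive definite 2×2 real matrix, and let P_t be a symmetric positive definite solution of A_tᵀP_t + P_tA_t = −Q_t, with p_m, p_M, q_m > 0 satisfying p_m‖z‖² ≤ zᵀP_t z ≤ p_M‖z‖² and zᵀQ_t z ≥ q_m‖z‖² for all z ∈ ℝ². Assume: k_{t3}·q_m/p_M − 1/(k_{t3}²·p_m) > 0; k_{TD}·min_i L_{Ti} − 1/2 > 0; and Γ_{t1} − m²/(2·p_m) > 0, where Γ_{t1} := min{ k_{t3}·q_m/p_M − 1/(k_{t3}²·p_m), 2κ_t − 1 }. Let e_b, e_v, e_φ, b̃, ṽ : [0,∞) → ℝ³ be differentiable and satisfy, for all t ≥ 0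 (with k = k_{t3}): e_b' = e_v; m·e_v' = −m·k_{t1}·φ₁ᵖᵏ(ψ_t) − m·κ_t·( ‖e_b‖^{2(1−p)/p}·H(e_b,(p−1)/p)·e_v + e_v ) + e_φ, where ψ_t := e_v + κ_t·( e_b + ‖e_b‖^{2(1−p)/p}·e_b ); e_φ' = −m·k_{t2}·φ₂ᵖᵏ(ψ_t); b̃' = ṽ; and m·ṽ' = e_φ − k_{TD}·L_T·( ψ_T + ‖ψ_T‖^{2(1−p)/p}·ψ_T ) − k_{TP}·L_T·b̃ − m·κ_T·( ṽ + ‖b̃‖^{2(1−p)/p}·H(b̃,(p−1)/p)·ṽ ), where ψ_T := ṽ + κ_T·( b̃ + ‖b̃‖^{2(1−p)/p}·b̃ ). Then there exists T ≥ 0 such that b̃(t) = 0, ṽ(t) = 0, e_b(t) = 0, e_v(t) = 0 and e_φ(t) = 0 for all t ≥ T. -/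
open scoped RealInnerProductSpace Matrix

/-- `φ₂ᵖᵏ(e) = k² e + (2k(2p-1)/(3p-2)) ‖e‖^(2(1-p)/(3p-2)) e
+ (p/(3p-2)) ‖e‖^(4(1-p)/(3p-2)) e` (value `0` at `e = 0`). -/
noncomputable def phi2 {n : ℕ} (p k : ℝ) (e : EuclideanSpace ℝ (Fin n)) :
    EuclideanSpace ℝ (Fin n) :=
  (k ^ 2) • e + ((2 * k * (2 * p - 1) / (3 * p - 2)) * ‖e‖ ^ (2 * (1 - p) / (3 * p - 2))) • e
    + ((p / (3 * p - 2)) * ‖e‖ ^ (4 * (1 - p) / (3 * p - 2))) • e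

/-- `H(x,c) v = v - (2c/‖x‖²) ⟨x,v⟩ x`. -/
noncomputable def Hact {n : ℕ} (x : EuclideanSpace ℝ (Fin n)) (c : ℝ)
    (v : EuclideanSpace ℝ (Fin n)) : EuclideanSpace ℝ (Fin n) :=
  v - ((2 * c / ‖x‖ ^ 2) * ⟪x, v⟫) • x

/-- `ψ = e_v + κ (e_b + ‖e_b‖^(2(1-p)/p) e_b)`. -/
noncomputable def psiV {n : ℕ} (p κ : ℝ) (eb ev : EuclideanSpace ℝ (Fin n)) :
    EuclideanSpace ℝ (Fin n) :=
  ev + κ • (eb + (‖eb‖ ^ (2 * (1 - p) / p)) • eb)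

/-- Plain vectors of `ℝ³` regarded as points of Euclidean 3-space. -/
noncomputable def toE3 (v : Fin 3 → ℝ) : EuclideanSpace ℝ (Fin 3) :=
  (WithLp.equiv 2 (Fin 3 → ℝ)).symm v

/-- Points of Euclidean 3-space regarded as plain vectors of `ℝ³`. -/
noncomputable def ofE3 (v : EuclideanSpace ℝ (Fin 3)) : Fin 3 → ℝ :=
  WithLp.equiv 2 (Fin 3 → ℝ) v

/-- Action of a `3 × 3` matrix on Euclidean 3-space. -/
noncomputable def matAct (M : Matrix (Fin 3) (Fin 3) ℝ) (v : EuclideanSpace ℝ (Fin 3)) :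
    EuclideanSpace ℝ (Fin 3) := toE3 (M.mulVec (ofE3 v))


open Filter Topology Set

section NormPower

variable {E : Type*} [NormedAddCommGroup E] [InnerProductSpace ℝ E]

theorem continuous_norm_rpow_smul {s : ℝ} (hs : -1 < s) :
    Continuous fun x : E => ‖x‖ ^ s • x := by
  rw [continuous_iff_continuousAt]
  intro x
  rcases eq_or_ne x 0 with rfl | hx
  · rw [ContinuousAt, smul_zero, tendsto_zero_iff_norm_tendsto_zero]
    have h : Tendsto (fun x : E => ‖x‖ ^ (s + 1)) (𝓝 0) (𝓝 0) := by
      have := (continuous_norm (E := E)).continuousAt.rpow_const (x := 0) (p := s + 1)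
        (Or.inr (by linarith))
      simpa [ContinuousAt, Real.zero_rpow (by linarith : s + 1 ≠ 0)] using this
    refine h.congr fun x => ?_
    rcases eq_or_ne x 0 with rfl | hx
    · simp [Real.zero_rpow (by linarith : s + 1 ≠ 0)]
    · rw [norm_smul, Real.norm_of_nonneg (by positivity), Real.rpow_add_one (by simpa using hx)]
  · exact (continuous_norm.continuousAt.rpow_const (Or.inl (by simpa using hx))).smul
      continuousAt_id

theorem hasDerivAt_norm_rpow_smul (s : ℝ) {b : ℝ → E} {v : E} {t : ℝ} (hb : HasDerivAt b v t)
    (h0 : b t ≠ 0) :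
    HasDerivAt (fun τ => ‖b τ‖ ^ s • b τ)
      (‖b t‖ ^ s • (v + (s / ‖b t‖ ^ 2 * inner ℝ (b t) v) • b t)) t := by
  have hn : 0 < ‖b t‖ := norm_pos_iff.2 h0
  have key : ∀ x : E, (‖x‖ ^ 2) ^ (s / 2) = ‖x‖ ^ s := fun x => by
    rw [← Real.rpow_natCast, ← Real.rpow_mul (norm_nonneg _)]
    congr 1
    push_cast
    ring
  have h := (hb.norm_sq.rpow_const (p := s / 2) (Or.inl (by positivity))).smul hb
  simp only [key] at h
  refine h.congr_deriv ?_
  rw [Real.rpow_sub (by positivity), key, Real.rpow_one, smul_add, smul_smul]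
  congr 2
  ring

/-- If `v + κ (b + ‖b‖ˢ b)` has a bounded derivative wherever `b ≠ 0`, where `-1 < s < 0`, then
the curve `b` with velocity `v` can reach the origin only with zero velocity. -/
theorem velocity_eq_zero_of_eq_zero {s κ t₀ : ℝ} (hs : -1 < s) (hs' : s < 0) (hκ : κ ≠ 0)
    {b v R : ℝ → E} {a : E} (hb : HasDerivAt b (v t₀) t₀) (hv : HasDerivAt v a t₀)
    (hψ : ∀ t, t₀ ≤ t → b t ≠ 0 →
      HasDerivAt (fun τ => v τ + κ • (b τ + ‖b τ‖ ^ s • b τ)) (R t) t)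
    (hR : ContinuousAt R t₀) (h0 : b t₀ = 0) : v t₀ = 0 := by
  by_contra hw
  have hne : ∀ᶠ t in 𝓝[>] t₀, b t ≠ 0 :=
    (hb.eventually_ne hw).filter_mono (nhdsWithin_mono _ fun x hx => ne_of_gt hx)
  have hbd : ∀ᶠ t in 𝓝[>] t₀, ‖R t‖ ≤ ‖R t₀‖ + 1 :=
    ((hR.norm.eventually_lt continuousAt_const (by simp)).mono fun _ h => h.le).filter_mono
      nhdsWithin_le_nhds
  obtain ⟨u, hu, hsub⟩ := mem_nhdsGT_iff_exists_Ioo_subset.1 (hne.and hbd)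
  set ψ : ℝ → E := fun τ => v τ + κ • (b τ + ‖b τ‖ ^ s • b τ) with hψdef
  have hψc : ContinuousAt ψ t₀ :=
    hv.continuousAt.add ((hb.continuousAt.add
      ((continuous_norm_rpow_smul hs).continuousAt.comp hb.continuousAt)).const_smul κ)
  have hlip : ∀ x ∈ Ioo t₀ u, ‖ψ x - ψ t₀‖ ≤ (‖R t₀‖ + 1) * ‖x - t₀‖ := by
    intro x hx
    have h1 : ∀ᶠ y in 𝓝[>] t₀, ‖ψ x - ψ y‖ ≤ (‖R t₀‖ + 1) * ‖x - y‖ := by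
      filter_upwards [Ioo_mem_nhdsGT hu] with y hy
      exact (convex_Ioo t₀ u).norm_image_sub_le_of_norm_hasDerivWithin_le
        (fun z hz => (hψ z hz.1.le (hsub hz).1).hasDerivWithinAt) (fun z hz => (hsub hz).2) hy hx
    have hc1 : Tendsto (fun y => ‖ψ x - ψ y‖) (𝓝[>] t₀) (𝓝 ‖ψ x - ψ t₀‖) :=
      (continuousAt_const.sub hψc).norm.tendsto.mono_left nhdsWithin_le_nhds
    have hc2 : Tendsto (fun y => (‖R t₀‖ + 1) * ‖x - y‖) (𝓝[>] t₀)
        (𝓝 ((‖R t₀‖ + 1) * ‖x - t₀‖)) :=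
      (Continuous.tendsto (by fun_prop) t₀).mono_left nhdsWithin_le_nhds
    exact le_of_tendsto_of_tendsto hc1 hc2 h1
  have hψO : (fun x => ψ x - ψ t₀) =O[𝓝[>] t₀] fun x => x - t₀ :=
    Asymptotics.IsBigO.of_bound _ (by filter_upwards [Ioo_mem_nhdsGT hu] with x hx using hlip x hx)
  have hvO := hv.isBigO_sub.mono (nhdsWithin_le_nhds (s := Ioi t₀))
  have hbO := hb.isBigO_sub.mono (nhdsWithin_le_nhds (s := Ioi t₀))
  have hpow : (fun x => ‖b x‖ ^ s • b x) =O[𝓝[>] t₀] fun x => x - t₀ := by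
    have := (((hψO.sub hvO).const_smul_left κ⁻¹).sub hbO)
    refine this.congr_left fun x => ?_
    have h1 : ψ x - ψ t₀ - (v x - v t₀) = κ • (b x + ‖b x‖ ^ s • b x) := by
      simp only [hψdef, h0, smul_zero, add_zero]
      abel
    rw [Pi.smul_apply, h1, inv_smul_smul₀ hκ, h0]
    abel
  have hrev : (fun x => x - t₀) =O[𝓝[>] t₀] b := by
    have h1 : Tendsto (fun x : ℝ => (x, t₀)) (𝓝[>] t₀) (𝓝 t₀ ×ˢ pure t₀) :=
      (tendsto_id.mono_left nhdsWithin_le_nhds).prodMk (tendsto_pure.2 (Eventually.of_forall fun _ => rfl))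
    have := (HasDerivAtFilter.isTheta_sub hb hw).2.comp_tendsto h1
    simpa [Function.comp_def, h0] using this
  obtain ⟨C, hC⟩ := (hpow.trans hrev).bound
  have hb0 : Tendsto (fun x => ‖b x‖) (𝓝[>] t₀) (𝓝[>] 0) := by
    refine tendsto_nhdsWithin_iff.2 ⟨?_, hne.mono fun x hx => norm_pos_iff.2 hx⟩
    have := hb.continuousAt.norm.tendsto.mono_left (nhdsWithin_le_nhds (s := Ioi t₀))
    simpa [h0] using this
  have hlarge := ((tendsto_rpow_neg_nhdsGT_zero hs').comp hb0).eventually_gt_atTop C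
  obtain ⟨x, hx1, hx2, hx3⟩ := (hC.and (hlarge.and hne)).exists
  rw [norm_smul, Real.norm_of_nonneg (by positivity)] at hx1
  exact absurd (le_of_mul_le_mul_right hx1 (norm_pos_iff.2 hx3)) (not_le.2 hx2)

end NormPower

/-- A nonnegative continuous function which, to the right of every point where it is positive,
satisfies `V' ≤ -c V ^ γ` with `γ < 1`, vanishes after a finite time. -/
theorem exists_eq_zero_of_deriv_le_neg_rpow {V : ℝ → ℝ} {a c γ : ℝ} (hc : 0 < c) (hγ : γ < 1)
    (hV : ContinuousOn V (Ici a)) (hV0 : ∀ t, a ≤ t → 0 ≤ V t)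
    (hd : ∀ t, a ≤ t → 0 < V t →
      ∀ᶠ s in 𝓝[>] t, ∃ d, HasDerivAt V d s ∧ d ≤ -c * V s ^ γ) :
    ∃ T, a ≤ T ∧ ∀ t, T ≤ t → V t = 0 := by
  have hγ' : 0 < 1 - γ := by linarith
  set W : ℝ → ℝ := fun t => V t ^ (1 - γ) with hW
  have hW0 : ∀ t, a ≤ t → 0 ≤ W t := fun t ht => Real.rpow_nonneg (hV0 t ht) _
  have hWc : ContinuousOn W (Ici a) := hV.rpow_const fun _ _ => Or.inr hγ'.le
  set C : ℝ := c * (1 - γ) with hCdef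
  have hC : 0 < C := by positivity
  have hdec : ∀ t, a ≤ t → 0 < W t → ∃ u > t, ∀ s ∈ Ioo t u, W s ≤ W t - C * (s - t) := by
    intro t ht hWt
    have hVt : 0 < V t := by
      refine (hV0 t ht).lt_of_ne fun h => hWt.ne' ?_
      simp [hW, ← h, Real.zero_rpow hγ'.ne']
    have hpos : ∀ᶠ s in 𝓝[>] t, 0 < V s :=
      ((hV t ht).mono fun x hx => ht.trans (le_of_lt hx)).eventually (lt_mem_nhds hVt)
    obtain ⟨u, hu, hsub⟩ := mem_nhdsGT_iff_exists_Ioo_subset.1 ((hd t ht hVt).and hpos)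
    refine ⟨u, hu, fun s hs => ?_⟩
    have hderiv : ∀ x ∈ Ioo t s, ∃ d ≤ 0, HasDerivAt (fun y => W y + C * y) d x := by
      intro x hx
      obtain ⟨⟨d, hd1, hd2⟩, hx0⟩ := hsub ⟨hx.1, hx.2.trans hs.2⟩
      refine ⟨_, ?_, (hd1.rpow_const (p := 1 - γ) (Or.inl hx0.ne')).add
        ((hasDerivAt_id x).const_mul C)⟩
      have h1 : d * V x ^ (1 - γ - 1) ≤ -c := by
        calc d * V x ^ (1 - γ - 1) ≤ -c * V x ^ γ * V x ^ (1 - γ - 1) := by gcongr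
          _ = -c := by
            rw [mul_assoc, ← Real.rpow_add hx0]
            simp
      nlinarith
    have hanti : AntitoneOn (fun y => W y + C * y) (Icc t s) := by
      refine antitoneOn_of_deriv_nonpos (convex_Icc t s) ?_ ?_ ?_
      · exact (hWc.mono fun x hx => ht.trans hx.1).add (by fun_prop)
      · rw [interior_Icc]
        intro x hx
        obtain ⟨d, -, h⟩ := hderiv x hx
        exact h.differentiableAt.differentiableWithinAt
      · rw [interior_Icc]
        intro x hx
        obtain ⟨d, hd0, h⟩ := hderiv x hx
        rwa [h.deriv]
    have : W s + C * s ≤ W t + C * t :=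
      hanti (left_mem_Icc.2 hs.1.le) (right_mem_Icc.2 hs.1.le) hs.1.le
    linarith
  have hbound : ∀ η > 0, ∀ t, a ≤ t → W t ≤ max η (W a + η - C * (t - a)) := by
    intro η hη t ht
    set U : ℝ → ℝ := fun t => max η (W a + η - C * (t - a)) with hU
    have hUc : Continuous U := by fun_prop
    have hcl : IsClosed ({x | W x ≤ U x} ∩ Icc a t) := by
      have := (hWc.mono (fun x hx => hx.1 : Icc a t ⊆ Ici a))
      rw [inter_comm]
      exact isClosed_Icc.isClosed_le this hUc.continuousOn
    refine hcl.Icc_subset_of_forall_exists_gt ?_ ?_ (right_mem_Icc.2 ht)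
    · change W a ≤ max η (W a + η - C * (a - a))
      exact le_max_of_le_right (by linarith)
    · rintro x ⟨hx, hx'⟩ y hy
      have hex : ∀ᶠ z in 𝓝[>] x, W z ≤ U z := by
        rcases (hW0 x hx'.1).eq_or_lt with h | h
        · have hlt : W x < U x := h ▸ lt_max_of_lt_left hη
          exact (((hWc x hx'.1).mono fun z hz => hx'.1.trans (le_of_lt hz)).eventually_lt
            hUc.continuousWithinAt hlt).mono fun _ h => h.le
        · obtain ⟨u, hu, hdu⟩ := hdec x hx'.1 h
          filter_upwards [Ioo_mem_nhdsGT hu] with z hz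
          have h2 := hdu z hz
          have h3 : 0 < C * (z - x) := mul_pos hC (sub_pos.2 hz.1)
          rcases le_max_iff.1 (show W x ≤ max η (W a + η - C * (x - a)) from hx) with h4 | h4
          · exact le_max_of_le_left (by linarith)
          · exact le_max_of_le_right (by linarith)
      obtain ⟨z, hz1, hz2⟩ := (hex.and (Ioc_mem_nhdsGT hy)).exists
      exact ⟨z, hz1, hz2⟩
  refine ⟨a + W a / C, le_add_of_nonneg_right (div_nonneg (hW0 a le_rfl) hC.le), fun t ht => ?_⟩
  have hat : a ≤ t := (le_add_of_nonneg_right (div_nonneg (hW0 a le_rfl) hC.le)).trans ht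
  have hle : W t ≤ 0 := by
    refine le_of_forall_pos_le_add fun η hη => ?_
    have h1 := hbound η hη t hat
    have h2 : W a ≤ C * (t - a) := by
      have : W a / C ≤ t - a := by linarith
      rwa [div_le_iff₀' hC] at this
    rwa [max_eq_left (by linarith), ← zero_add η] at h1
  exact (Real.rpow_eq_zero (hV0 t hat) hγ'.ne').1 (le_antisymm hle (hW0 t hat))

section Lyapunov

variable {n : ℕ}

/-- The quadratic form of a symmetric `2 × 2` matrix on pairs of vectors. -/
noncomputable def blockForm (P : Matrix (Fin 2) (Fin 2) ℝ) (x y : EuclideanSpace ℝ (Fin n)) : ℝ :=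
  P 0 0 * inner ℝ x x + (P 0 1 + P 1 0) * inner ℝ x y + P 1 1 * inner ℝ y y

theorem blockForm_eq_sum (P : Matrix (Fin 2) (Fin 2) ℝ) (x y : EuclideanSpace ℝ (Fin n)) :
    blockForm P x y = ∑ i, ![x i, y i] ⬝ᵥ P.mulVec ![x i, y i] := by
  simp only [blockForm, PiLp.inner_apply, Finset.mul_sum, ← Finset.sum_add_distrib]
  refine Finset.sum_congr rfl fun i _ => ?_
  simp [Matrix.mulVec, dotProduct, Fin.sum_univ_two]
  ring

theorem sum_sq_eq_norm_sq_add_norm_sq (x y : EuclideanSpace ℝ (Fin n)) :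
    ∑ i, (![x i, y i] 0 ^ 2 + ![x i, y i] 1 ^ 2) = ‖x‖ ^ 2 + ‖y‖ ^ 2 := by
  simp [EuclideanSpace.real_norm_sq_eq, Finset.sum_add_distrib]

theorem mul_le_blockForm {P : Matrix (Fin 2) (Fin 2) ℝ} {c : ℝ}
    (h : ∀ z : Fin 2 → ℝ, c * (z 0 ^ 2 + z 1 ^ 2) ≤ z ⬝ᵥ P.mulVec z)
    (x y : EuclideanSpace ℝ (Fin n)) : c * (‖x‖ ^ 2 + ‖y‖ ^ 2) ≤ blockForm P x y := by
  rw [blockForm_eq_sum, ← sum_sq_eq_norm_sq_add_norm_sq, Finset.mul_sum]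
  exact Finset.sum_le_sum fun i _ => h _

theorem blockForm_le_mul {P : Matrix (Fin 2) (Fin 2) ℝ} {c : ℝ}
    (h : ∀ z : Fin 2 → ℝ, z ⬝ᵥ P.mulVec z ≤ c * (z 0 ^ 2 + z 1 ^ 2))
    (x y : EuclideanSpace ℝ (Fin n)) : blockForm P x y ≤ c * (‖x‖ ^ 2 + ‖y‖ ^ 2) := by
  rw [blockForm_eq_sum, ← sum_sq_eq_norm_sq_add_norm_sq, Finset.mul_sum]
  exact Finset.sum_le_sum fun i _ => h _

theorem phi_exponent_bounds {p : ℝ} (hp : p ∈ Ioo (1 : ℝ) 2) :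
    -1 / 2 < 2 * (1 - p) / (3 * p - 2) ∧ 2 * (1 - p) / (3 * p - 2) < 0 := by
  obtain ⟨h1, h2⟩ := hp
  have : 0 < 3 * p - 2 := by linarith
  constructor
  · rw [div_lt_div_iff₀ (by norm_num) this]
    linarith
  · rw [div_lt_iff₀ this]
    linarith

theorem continuous_phi1 {p : ℝ} (hp : p ∈ Ioo (1 : ℝ) 2) (k : ℝ) :
    Continuous (phi1 (n := n) p k) :=
  (continuous_id.const_smul k).add
    (continuous_norm_rpow_smul (by linarith [(phi_exponent_bounds hp).1]))

theorem phi1_eq_smul (p k : ℝ) (e : EuclideanSpace ℝ (Fin n)) :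
    phi1 p k e = (k + ‖e‖ ^ (2 * (1 - p) / (3 * p - 2))) • e := by
  rw [phi1, add_smul]

theorem phi2_eq_smul {p : ℝ} (hp : p ∈ Ioo (1 : ℝ) 2) (k : ℝ) {e : EuclideanSpace ℝ (Fin n)}
    {s r : ℝ} (hs : s = 2 * (1 - p) / (3 * p - 2)) (hr : r = ‖e‖ ^ s) :
    phi2 p k e = (k ^ 2 + k * (2 + s) * r + (1 + s) * r ^ 2) • e := by
  have h3 : 3 * p - 2 ≠ 0 := by linarith [hp.1]
  have h4 : 4 * (1 - p) / (3 * p - 2) = s * (2 : ℕ) := by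
    rw [hs]
    push_cast
    ring
  have h5 : 2 * k * (2 * p - 1) / (3 * p - 2) = k * (2 + s) := by
    rw [div_eq_iff h3, mul_assoc k, add_mul, hs, div_mul_cancel₀ _ h3]
    ring
  have h6 : p / (3 * p - 2) = 1 + s := by
    rw [div_eq_iff h3, add_mul, hs, div_mul_cancel₀ _ h3]
    ring
  rw [phi2, h4, h5, h6, Real.rpow_mul (norm_nonneg _), Real.rpow_natCast, ← hs, ← hr, ← add_smul,
    ← add_smul]

/-- Along the observer error dynamics the Lyapunov function decays at the rate given by the
smallest eigenvalue of the derivative of `phi1`. -/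
theorem hasDerivAt_blockForm_phi1 {p k k₁ k₂ q : ℝ} (hp : p ∈ Ioo (1 : ℝ) 2) (hk : 0 < k)
    (hq : 0 ≤ q) {P Q : Matrix (Fin 2) (Fin 2) ℝ}
    (h00 : Q 0 0 = 2 * k₁ * P 0 0 + k₂ * (P 0 1 + P 1 0))
    (h01 : Q 0 1 + Q 1 0 = k₁ * (P 0 1 + P 1 0) + 2 * k₂ * P 1 1 - 2 * P 0 0)
    (h11 : Q 1 1 = -(P 0 1 + P 1 0))
    (hQ : ∀ z : Fin 2 → ℝ, q * (z 0 ^ 2 + z 1 ^ 2) ≤ z ⬝ᵥ Q.mulVec z)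
    {ψ ε : ℝ → EuclideanSpace ℝ (Fin n)} {t : ℝ} (h0 : ψ t ≠ 0)
    (hψ : HasDerivAt ψ (-k₁ • phi1 p k (ψ t) + ε t) t)
    (hε : HasDerivAt ε (-k₂ • phi2 p k (ψ t)) t) :
    ∃ d, HasDerivAt (fun τ => blockForm P (phi1 p k (ψ τ)) (ε τ)) d t ∧
      d ≤ -(q * (1 + 2 * (1 - p) / (3 * p - 2))) * (‖ψ t‖ ^ (2 * (1 - p) / (3 * p - 2)) *
        (‖phi1 p k (ψ t)‖ ^ 2 + ‖ε t‖ ^ 2)) := by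
  obtain ⟨hs1, hs2⟩ := phi_exponent_bounds hp
  obtain ⟨s, hs⟩ : ∃ s, s = 2 * (1 - p) / (3 * p - 2) := ⟨_, rfl⟩
  obtain ⟨r, hr⟩ : ∃ r, r = ‖ψ t‖ ^ s := ⟨_, rfl⟩
  have hφ : HasDerivAt (fun τ => phi1 p k (ψ τ)) _ t :=
    (hψ.const_smul k).add (hasDerivAt_norm_rpow_smul (2 * (1 - p) / (3 * p - 2)) hψ h0)
  refine ⟨_, (((hφ.inner ℝ hφ).const_mul (P 0 0)).add
    ((hφ.inner ℝ hε).const_mul (P 0 1 + P 1 0))).add ((hε.inner ℝ hε).const_mul (P 1 1)), ?_⟩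
  have hform := mul_le_blockForm hQ (phi1 p k (ψ t)) (ε t)
  have hQ11 : 0 ≤ Q 1 1 := by
    have := hQ ![0, 1]
    simp [Matrix.mulVec, dotProduct, Fin.sum_univ_two] at this
    linarith
  have hcs := real_inner_mul_inner_self_le (ψ t) (ε t)
  rw [phi2_eq_smul hp k hs hr]
  rw [phi1_eq_smul] at hform ⊢
  rw [← hs] at hs1 hs2 hform ⊢
  rw [← hr] at hform ⊢
  have hr0 : 0 < r := hr ▸ Real.rpow_pos_of_pos (norm_pos_iff.2 h0) _
  have hN0 : 0 < inner ℝ (ψ t) (ψ t) := real_inner_self_pos.2 h0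
  have he0 : 0 ≤ inner ℝ (ε t) (ε t) := real_inner_self_nonneg
  rw [blockForm] at hform
  simp only [← real_inner_self_eq_norm_sq] at hform ⊢
  simp only [inner_add_left, inner_add_right, real_inner_smul_left, real_inner_smul_right,
    real_inner_comm (ψ t) (ε t), smul_add, neg_smul, inner_neg_left, inner_neg_right] at hform hcs ⊢
  generalize inner ℝ (ψ t) (ψ t) = N at *
  generalize inner ℝ (ψ t) (ε t) = w at *
  generalize inner ℝ (ε t) (ε t) = e at *
  have hdecay : 0 ≤ -s * r * Q 1 1 * (e - w * w / N) := by
    have : 0 ≤ e - w * w / N := by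
      rw [sub_nonneg, div_le_iff₀ hN0]
      linarith
    have : 0 ≤ -s * r := mul_nonneg (by linarith) hr0.le
    positivity
  have hform' := mul_le_mul_of_nonneg_left hform
    (add_nonneg hk.le (mul_nonneg hr0.le (by linarith : 0 ≤ 1 + s)))
  have hS : 0 ≤ k * (q * ((k + r) * ((k + r) * N) + e)) := by
    positivity
  have key : ∀ d : ℝ, d = -((k + r * (1 + s)) * (Q 0 0 * ((k + r) * ((k + r) * N)) +
      (Q 0 1 + Q 1 0) * ((k + r) * w) + Q 1 1 * e)) - (-s * r * Q 1 1 * (e - w * w / N)) →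
      d ≤ -(q * (1 + s)) * (r * ((k + r) * ((k + r) * N) + e)) := by
    rintro d rfl
    linarith
  refine key _ ?_
  rw [h00, h01, h11]
  field_simp
  ring

end Lyapunov

section Settling

variable {n : ℕ}

theorem psi_exponent_bounds {p : ℝ} (hp : p ∈ Ioo (1 : ℝ) 2) :
    -1 < 2 * (1 - p) / p ∧ 2 * (1 - p) / p < 0 := by
  obtain ⟨h1, h2⟩ := hp
  have : 0 < p := by linarith
  constructor
  · rw [lt_div_iff₀ this]
    linarith
  · rw [div_lt_iff₀ this]
    linarith

theorem hasDerivAt_psiV (p κ : ℝ) {b v : ℝ → EuclideanSpace ℝ (Fin n)}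
    {a : EuclideanSpace ℝ (Fin n)} {t : ℝ} (hb : HasDerivAt b (v t) t) (hv : HasDerivAt v a t)
    (h0 : b t ≠ 0) :
    HasDerivAt (fun τ => psiV p κ (b τ) (v τ))
      (a + κ • (v t + (‖b t‖ ^ (2 * (1 - p) / p)) • Hact (b t) ((p - 1) / p) (v t))) t := by
  refine (hv.add ((hb.add (hasDerivAt_norm_rpow_smul (2 * (1 - p) / p) hb h0)).const_smul
    κ)).congr_deriv ?_
  rw [Hact, show 2 * (1 - p) / p = -(2 * ((p - 1) / p)) by ring, neg_div, neg_mul, neg_smul,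
    ← sub_eq_add_neg]

theorem continuousAt_psiV {p : ℝ} (hp : p ∈ Ioo (1 : ℝ) 2) (κ : ℝ)
    {b v : ℝ → EuclideanSpace ℝ (Fin n)} {t : ℝ} (hb : ContinuousAt b t) (hv : ContinuousAt v t) :
    ContinuousAt (fun τ => psiV p κ (b τ) (v τ)) t :=
  hv.add ((hb.add ((continuous_norm_rpow_smul (psi_exponent_bounds hp).1).continuousAt.comp
    hb)).const_smul κ)

theorem psiV_zero (p κ : ℝ) : psiV p κ (0 : EuclideanSpace ℝ (Fin n)) 0 = 0 := by
  simp [psiV]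

theorem norm_rpow_mul_norm_sq {p : ℝ} (hp : p ∈ Ioo (1 : ℝ) 2) (x : EuclideanSpace ℝ (Fin n)) :
    ‖x‖ ^ (2 * (1 - p) / p) * ‖x‖ ^ 2 = (‖x‖ ^ 2) ^ (1 / p) := by
  have hp0 : p ≠ 0 := by linarith [hp.1]
  rcases eq_or_ne x 0 with rfl | hx
  · simp [Real.zero_rpow (inv_ne_zero hp0)]
  · have hx' : 0 < ‖x‖ := norm_pos_iff.2 hx
    rw [← Real.rpow_natCast, ← Real.rpow_mul hx'.le, ← Real.rpow_add hx']
    congr 1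
    push_cast
    field_simp
    ring

theorem mul_rpow_le_rpow_mul {p x S V M : ℝ} (hp : p ∈ Ioo (1 : ℝ) 2) (hx : 0 < x) (hM : 0 < M)
    (hS : (x ^ (2 * (1 - p) / (3 * p - 2)) * x) ^ 2 ≤ S) (hV0 : 0 ≤ V) (hV : V ≤ M * S) :
    (1 / M) ^ (1 / p) * V ^ (1 / p) ≤ x ^ (2 * (1 - p) / (3 * p - 2)) * S := by
  have hp0 : 0 < p := by linarith [hp.1]
  have h3 : 0 < 3 * p - 2 := by linarith [hp.1]
  have hS0 : 0 < S := lt_of_lt_of_le (by positivity) hS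
  calc (1 / M) ^ (1 / p) * V ^ (1 / p) = (1 / M * V) ^ (1 / p) :=
        (Real.mul_rpow (by positivity) hV0).symm
    _ ≤ S ^ (1 / p) := by
        refine Real.rpow_le_rpow (by positivity) ?_ (by positivity)
        rw [one_div, inv_mul_le_iff₀ hM]
        exact hV
    _ = S ^ ((1 - p) / p) * S := by
        rw [← Real.rpow_add_one hS0.ne']
        congr 1
        field_simp
        ring
    _ ≤ ((x ^ (2 * (1 - p) / (3 * p - 2)) * x) ^ 2) ^ ((1 - p) / p) * S := by
        refine mul_le_mul_of_nonneg_right ?_ hS0.le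
        exact Real.rpow_le_rpow_of_nonpos (by positivity) hS
          (div_nonpos_of_nonpos_of_nonneg (sub_nonpos.2 hp.1.le) hp0.le)
    _ = x ^ (2 * (1 - p) / (3 * p - 2)) * S := by
        rw [← Real.rpow_add_one hx.ne', ← Real.rpow_natCast, ← Real.rpow_mul hx.le,
          ← Real.rpow_mul hx.le]
        congr 2
        push_cast
        rw [div_add_one h3.ne']
        field_simp
        ring

theorem HasDerivAt.eventually_pos_right {f : ℝ → ℝ} {f' t : ℝ} (hf : HasDerivAt f f' t)
    (h0 : f t = 0) (hf' : 0 < f') : ∀ᶠ s in 𝓝[>] t, 0 < f s := by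
  have h := (hasDerivAt_iff_tendsto_slope.1 hf).mono_left
    (nhdsWithin_mono t fun x (hx : t < x) => hx.ne')
  filter_upwards [h.eventually (lt_mem_nhds hf'), self_mem_nhdsWithin] with s hs hts
  rw [slope_def_field, h0, sub_zero] at hs
  exact (div_pos_iff_of_pos_right (sub_pos.2 hts)).1 hs

/-- A curve which starts at the origin with zero velocity and nonzero acceleration `a` leaves
the origin, and so does `psiV`. -/
theorem eventually_ne_zero_of_acceleration_ne_zero {p κ : ℝ} (hκ : 0 < κ)
    {b v : ℝ → EuclideanSpace ℝ (Fin n)} {a : EuclideanSpace ℝ (Fin n)} {t : ℝ}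
    (hb : ∀ s, t ≤ s → HasDerivAt b (v s) s) (hv : HasDerivAt v a t) (ha : a ≠ 0)
    (hb0 : b t = 0) (hv0 : v t = 0) :
    ∀ᶠ s in 𝓝[>] t, b s ≠ 0 ∧ psiV p κ (b s) (v s) ≠ 0 := by
  have hva : HasDerivAt (fun s => inner ℝ a (v s)) (inner ℝ a a) t := by
    simpa using (hasDerivAt_const t a).inner ℝ hv
  have hpos := hva.eventually_pos_right (by simp [hv0]) (real_inner_self_pos.2 ha)
  obtain ⟨u, hu, hsub⟩ := mem_nhdsGT_iff_exists_Ioo_subset.1 hpos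
  have hba : ∀ s, t ≤ s → HasDerivAt (fun s => inner ℝ a (b s)) (inner ℝ a (v s)) s := fun s hs => by
    simpa using (hasDerivAt_const s a).inner ℝ (hb s hs)
  filter_upwards [Ioo_mem_nhdsGT hu] with s hs
  have hmono : StrictMonoOn (fun s => inner ℝ a (b s)) (Icc t s) := by
    refine strictMonoOn_of_deriv_pos (convex_Icc t s)
      (fun x hx => (hba x hx.1).continuousAt.continuousWithinAt) fun x hx => ?_
    rw [interior_Icc] at hx
    rw [(hba x hx.1.le).deriv]
    exact hsub ⟨hx.1, hx.2.trans hs.2⟩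
  have hbs : 0 < inner ℝ a (b s) := by
    simpa [hb0] using hmono (left_mem_Icc.2 hs.1.le) (right_mem_Icc.2 hs.1.le) hs.1
  have hvs : 0 < inner ℝ a (v s) := hsub hs
  constructor
  · intro h
    simp [h] at hbs
  · intro h
    have h1 : inner ℝ a (psiV p κ (b s) (v s)) = 0 := by rw [h, inner_zero_right]
    rw [psiV, inner_add_right, real_inner_smul_right, inner_add_right,
      real_inner_smul_right] at h1
    have : 0 < κ * (inner ℝ a (b s) + ‖b s‖ ^ (2 * (1 - p) / p) * inner ℝ a (b s)) := by
      positivity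
    linarith

/-- The sliding variable and the disturbance estimate of the observer settle in finite time. -/
theorem exists_observer_settling {p k k₁ k₂ κ m q pm pM : ℝ} (hp : p ∈ Ioo (1 : ℝ) 2) (hk : 0 < k)
    (hκ : 0 < κ) (hm : 0 < m) (hq : 0 < q) (hpm : 0 < pm) (hpM : 0 < pM)
    {P Q : Matrix (Fin 2) (Fin 2) ℝ}
    (h00 : Q 0 0 = 2 * k₁ * P 0 0 + k₂ * (P 0 1 + P 1 0))
    (h01 : Q 0 1 + Q 1 0 = k₁ * (P 0 1 + P 1 0) + 2 * k₂ * P 1 1 - 2 * P 0 0)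
    (h11 : Q 1 1 = -(P 0 1 + P 1 0))
    (hPlow : ∀ z : Fin 2 → ℝ, pm * (z 0 ^ 2 + z 1 ^ 2) ≤ z ⬝ᵥ P.mulVec z)
    (hPup : ∀ z : Fin 2 → ℝ, z ⬝ᵥ P.mulVec z ≤ pM * (z 0 ^ 2 + z 1 ^ 2))
    (hQ : ∀ z : Fin 2 → ℝ, q * (z 0 ^ 2 + z 1 ^ 2) ≤ z ⬝ᵥ Q.mulVec z)
    {b v φ : ℝ → EuclideanSpace ℝ (Fin n)}
    (hb : ∀ t : ℝ, 0 ≤ t → HasDerivAt b (v t) t)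
    (hv : ∀ t : ℝ, 0 ≤ t → HasDerivAt v
      (m⁻¹ • (-(m * k₁) • phi1 p k (psiV p κ (b t) (v t))
        - (m * κ) • ((‖b t‖ ^ (2 * (1 - p) / p)) • Hact (b t) ((p - 1) / p) (v t) + v t)
        + φ t)) t)
    (hφ : ∀ t : ℝ, 0 ≤ t → HasDerivAt φ (-(m * k₂) • phi2 p k (psiV p κ (b t) (v t))) t) :
    ∃ T, 0 ≤ T ∧ ∀ t, T ≤ t → psiV p κ (b t) (v t) = 0 ∧ φ t = 0 := by
  obtain ⟨hs1, hs2⟩ := phi_exponent_bounds hp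
  set ψ : ℝ → EuclideanSpace ℝ (Fin n) := fun t => psiV p κ (b t) (v t) with hψdef
  set ε : ℝ → EuclideanSpace ℝ (Fin n) := fun t => m⁻¹ • φ t with hεdef
  have hψ : ∀ t, 0 ≤ t → b t ≠ 0 → HasDerivAt ψ (-k₁ • phi1 p k (ψ t) + ε t) t := by
    intro t ht h0
    refine (hasDerivAt_psiV p κ (hb t ht) (hv t ht) h0).congr_deriv ?_
    rw [smul_add, smul_sub, smul_smul, smul_smul, inv_mul_cancel_left₀ hm.ne',
      show m⁻¹ * -(m * k₁) = -k₁ by field_simp, add_comm (v t)]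
    abel
  have hε : ∀ t, 0 ≤ t → HasDerivAt ε (-k₂ • phi2 p k (ψ t)) t := by
    intro t ht
    refine ((hφ t ht).const_smul m⁻¹).congr_deriv ?_
    rw [smul_smul, show m⁻¹ * -(m * k₂) = -k₂ by field_simp]
  have hψc : ∀ t, 0 ≤ t → ContinuousAt ψ t := fun t ht =>
    continuousAt_psiV hp κ (hb t ht).continuousAt (hv t ht).continuousAt
  have hφ1c : ∀ t, 0 ≤ t → ContinuousAt (fun τ => phi1 p k (ψ τ)) t := fun t ht =>
    (continuous_phi1 hp k).continuousAt.comp (hψc t ht)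
  have hv0 : ∀ t, 0 ≤ t → b t = 0 → v t = 0 := fun t ht h0 =>
    velocity_eq_zero_of_eq_zero (psi_exponent_bounds hp).1 (psi_exponent_bounds hp).2 hκ.ne'
      (hb t ht) (hv t ht) (fun s hs h => hψ s (ht.trans hs) h)
      (((hφ1c t ht).const_smul (-k₁)).add (hε t ht).continuousAt) h0
  have hlow : ∀ t, pm * (‖phi1 p k (ψ t)‖ ^ 2 + ‖ε t‖ ^ 2) ≤ blockForm P (phi1 p k (ψ t)) (ε t) :=
    fun t => mul_le_blockForm hPlow _ _
  have hV0 : ∀ t, 0 ≤ blockForm P (phi1 p k (ψ t)) (ε t) := fun t =>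
    le_trans (by positivity) (hlow t)
  have hleave : ∀ t, 0 ≤ t → 0 < blockForm P (phi1 p k (ψ t)) (ε t) →
      ∀ᶠ s in 𝓝[>] t, b s ≠ 0 ∧ ψ s ≠ 0 := by
    intro t ht hVt
    have hε0 : ψ t = 0 → ε t ≠ 0 := by
      intro h h'
      simp [h, h', phi1, blockForm] at hVt
    rcases eq_or_ne (b t) 0 with h0 | h0
    · have hvt := hv0 t ht h0
      have hψt : ψ t = 0 := by simp only [hψdef, h0, hvt, psiV_zero]
      refine eventually_ne_zero_of_acceleration_ne_zero hκ (fun s hs => hb s (ht.trans hs))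
        ((hv t ht).congr_deriv (g' := ε t) ?_) (hε0 hψt) h0 hvt
      simp [h0, hvt, psiV_zero, phi1, Hact, hεdef]
    · refine (((hb t ht).continuousAt.eventually_ne h0).filter_mono nhdsWithin_le_nhds).and ?_
      rcases eq_or_ne (ψ t) 0 with h1 | h1
      · refine ((hψ t ht h0).eventually_ne ?_).filter_mono
          (nhdsWithin_mono t fun x (hx : t < x) => hx.ne')
        simpa [h1, phi1] using hε0 h1
      · exact ((hψc t ht).eventually_ne h1).filter_mono nhdsWithin_le_nhds
  have hp0 : 0 < p := by linarith [hp.1]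
  have hdecay : ∀ t, 0 ≤ t → 0 < blockForm P (phi1 p k (ψ t)) (ε t) → ∀ᶠ s in 𝓝[>] t,
      ∃ d, HasDerivAt (fun t => blockForm P (phi1 p k (ψ t)) (ε t)) d s ∧
        d ≤ -(q * (1 + 2 * (1 - p) / (3 * p - 2)) * (1 / pM) ^ (1 / p)) *
          blockForm P (phi1 p k (ψ s)) (ε s) ^ (1 / p) := by
    intro t ht hVt
    filter_upwards [hleave t ht hVt, self_mem_nhdsWithin] with s hs hts
    have hs0 : 0 ≤ s := ht.trans (le_of_lt hts)
    obtain ⟨d, hd, hdle⟩ := hasDerivAt_blockForm_phi1 hp hk hq.le h00 h01 h11 hQ hs.2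
      (hψ s hs0 hs.1) (hε s hs0)
    refine ⟨d, hd, hdle.trans ?_⟩
    rw [neg_mul, neg_mul, neg_le_neg_iff, mul_assoc]
    refine mul_le_mul_of_nonneg_left ?_ (mul_nonneg hq.le (by linarith))
    have hpos : 0 < ‖ψ s‖ := norm_pos_iff.2 hs.2
    refine mul_rpow_le_rpow_mul hp hpos hpM ?_ (hV0 s) (blockForm_le_mul hPup _ _)
    refine le_add_of_le_of_nonneg ?_ (sq_nonneg _)
    rw [phi1_eq_smul, norm_smul, Real.norm_of_nonneg (by positivity)]
    gcongr
    linarith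
  obtain ⟨T, hT, hzero⟩ := exists_eq_zero_of_deriv_le_neg_rpow
    (V := fun t => blockForm P (phi1 p k (ψ t)) (ε t)) (a := 0) (γ := 1 / p)
    (c := q * (1 + 2 * (1 - p) / (3 * p - 2)) * (1 / pM) ^ (1 / p))
    (mul_pos (mul_pos hq (by linarith)) (by positivity))
    (by rw [div_lt_one hp0]; exact hp.1)
    (fun t ht => ContinuousAt.continuousWithinAt <|
      ((((hφ1c t ht).inner (hφ1c t ht)).const_mul (P 0 0)).add
        (((hφ1c t ht).inner (hε t ht).continuousAt).const_mul (P 0 1 + P 1 0))).add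
        (((hε t ht).continuousAt.inner (hε t ht).continuousAt).const_mul (P 1 1)))
    (fun t _ => hV0 t) hdecay
  refine ⟨T, hT, fun t ht => ?_⟩
  have h := hlow t
  have hz : blockForm P (phi1 p k (ψ t)) (ε t) = 0 := hzero t ht
  rw [hz] at h
  have hsum : ‖phi1 p k (ψ t)‖ ^ 2 + ‖ε t‖ ^ 2 ≤ 0 := nonpos_of_mul_nonpos_right h hpm
  have h1 : ‖phi1 p k (ψ t)‖ = 0 := by nlinarith [sq_nonneg ‖phi1 p k (ψ t)‖, sq_nonneg ‖ε t‖]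
  have h2 : ‖ε t‖ = 0 := by nlinarith [sq_nonneg ‖phi1 p k (ψ t)‖, sq_nonneg ‖ε t‖]
  rw [norm_eq_zero] at h1 h2
  rw [phi1_eq_smul, smul_eq_zero_iff_right (by positivity)] at h1
  exact ⟨h1, (smul_eq_zero_iff_right (inv_ne_zero hm.ne')).1 h2⟩

/-- On the sliding surface `psiV = 0` the position reaches the origin in finite time. -/
theorem exists_settling_of_psiV_eq_zero {p κ a : ℝ} (hp : p ∈ Ioo (1 : ℝ) 2) (hκ : 0 < κ)
    {b v : ℝ → EuclideanSpace ℝ (Fin n)} (hb : ∀ t, a ≤ t → HasDerivAt b (v t) t)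
    (hψ : ∀ t, a ≤ t → psiV p κ (b t) (v t) = 0) :
    ∃ T, a ≤ T ∧ ∀ t, T ≤ t → b t = 0 ∧ v t = 0 := by
  have hv : ∀ t, a ≤ t → v t = -(κ • (b t + ‖b t‖ ^ (2 * (1 - p) / p) • b t)) := fun t ht =>
    eq_neg_of_add_eq_zero_left (hψ t ht)
  have hp0 : 0 < p := by linarith [hp.1]
  have hdecay : ∀ t, a ≤ t → 0 < ‖b t‖ ^ 2 → ∀ᶠ s in 𝓝[>] t,
      ∃ d, HasDerivAt (fun t => ‖b t‖ ^ 2) d s ∧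
        d ≤ -(2 * κ) * (‖b s‖ ^ 2) ^ (1 / p) := by
    intro t ht _
    filter_upwards [self_mem_nhdsWithin] with s hts
    have hs : a ≤ s := ht.trans (le_of_lt hts)
    refine ⟨_, (hb s hs).norm_sq, ?_⟩
    rw [← norm_rpow_mul_norm_sq hp, hv s hs, inner_neg_right, real_inner_smul_right,
      inner_add_right, real_inner_smul_right, real_inner_self_eq_norm_sq]
    have : 0 ≤ κ * ‖b s‖ ^ 2 := by positivity
    linarith
  obtain ⟨T, hT, hzero⟩ := exists_eq_zero_of_deriv_le_neg_rpow
    (V := fun t => ‖b t‖ ^ 2) (a := a) (γ := 1 / p) (c := 2 * κ) (by positivity)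
    (by rw [div_lt_one hp0]; exact hp.1)
    (fun t ht => ((hb t ht).continuousAt.norm.pow 2).continuousWithinAt)
    (fun t _ => by positivity) hdecay
  refine ⟨T, hT, fun t ht => ?_⟩
  have h0 : b t = 0 := by simpa using hzero t ht
  exact ⟨h0, by rw [hv t (hT.trans ht), h0]; simp⟩

theorem matAct_diagonal_apply (L : Fin 3 → ℝ) (x : EuclideanSpace ℝ (Fin 3)) (i : Fin 3) :
    matAct (Matrix.diagonal L) x i = L i * x i := by
  simp [matAct, toE3, ofE3, Matrix.mulVec_diagonal]

theorem continuous_matAct (M : Matrix (Fin 3) (Fin 3) ℝ) : Continuous (matAct M) :=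
  (Matrix.toEuclideanCLM (n := Fin 3) (𝕜 := ℝ) M).continuous

/-- Without estimation error, the position tracking errors settle in finite time. -/
theorem exists_controller_settling {p m κ kD kP a : ℝ} (hp : p ∈ Ioo (1 : ℝ) 2) (hm : 0 < m)
    (hκ : 0 < κ) (hkD : 0 < kD) (hkP : 0 < kP) {L : Fin 3 → ℝ} (hL : ∀ i, 0 < L i)
    {b v : ℝ → EuclideanSpace ℝ (Fin 3)} (hb : ∀ t, a ≤ t → HasDerivAt b (v t) t)
    (hv : ∀ t, a ≤ t → HasDerivAt v
      (m⁻¹ • (-(kD • matAct (Matrix.diagonal L) (psiV p κ (b t) (v t) +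
            (‖psiV p κ (b t) (v t)‖ ^ (2 * (1 - p) / p)) • psiV p κ (b t) (v t)))
        - kP • matAct (Matrix.diagonal L) (b t)
        - (m * κ) • (v t + (‖b t‖ ^ (2 * (1 - p) / p)) •
            Hact (b t) ((p - 1) / p) (v t)))) t) :
    ∃ T, a ≤ T ∧ ∀ t, T ≤ t → b t = 0 ∧ v t = 0 := by
  obtain ⟨hs1, hs2⟩ := psi_exponent_bounds hp
  have hp0 : 0 < p := by linarith [hp.1]
  set ψ : ℝ → EuclideanSpace ℝ (Fin 3) := fun t => psiV p κ (b t) (v t) with hψdef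
  set R : ℝ → EuclideanSpace ℝ (Fin 3) := fun t =>
    m⁻¹ • (-(kD • matAct (Matrix.diagonal L) (ψ t + (‖ψ t‖ ^ (2 * (1 - p) / p)) • ψ t))
      - kP • matAct (Matrix.diagonal L) (b t)) with hRdef
  have hψ : ∀ t, a ≤ t → b t ≠ 0 → HasDerivAt ψ (R t) t := by
    intro t ht h0
    refine (hasDerivAt_psiV p κ (hb t ht) (hv t ht) h0).congr_deriv ?_
    rw [smul_sub, smul_smul, inv_mul_cancel_left₀ hm.ne', sub_add_cancel]
  have hψc : ∀ t, a ≤ t → ContinuousAt ψ t := fun t ht =>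
    continuousAt_psiV hp κ (hb t ht).continuousAt (hv t ht).continuousAt
  have hRc : ∀ t, a ≤ t → ContinuousAt R t := by
    intro t ht
    have hLc := (continuous_matAct (Matrix.diagonal L))
    have h1 : ContinuousAt (fun τ => ψ τ + (‖ψ τ‖ ^ (2 * (1 - p) / p)) • ψ τ) t :=
      (hψc t ht).add ((continuous_norm_rpow_smul hs1).continuousAt.comp (hψc t ht))
    exact ((((hLc.continuousAt.comp h1).const_smul kD).neg).sub
      ((hLc.continuousAt.comp (hb t ht).continuousAt).const_smul kP)).const_smul m⁻¹
  have hv0 : ∀ t, a ≤ t → b t = 0 → v t = 0 := fun t ht h0 =>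
    velocity_eq_zero_of_eq_zero hs1 hs2 hκ.ne' (hb t ht) (hv t ht)
      (fun s hs h => hψ s (ht.trans hs) h) (hRc t ht) h0
  set V : ℝ → ℝ := fun t => m / 2 * ∑ i, (ψ t i) ^ 2 / L i + kP / 2 * ‖b t‖ ^ 2 with hVdef
  set M : ℝ := m / 2 * ∑ i, 1 / L i + kP / 2 with hMdef
  have hLsum : 0 ≤ ∑ i, 1 / L i := Finset.sum_nonneg fun i _ => (one_div_pos.2 (hL i)).le
  have hM : 0 < M := by positivity
  have hsum0 : ∀ t, 0 ≤ ∑ i, (ψ t i) ^ 2 / L i := fun t =>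
    Finset.sum_nonneg fun i _ => div_nonneg (sq_nonneg _) (hL i).le
  have hV0 : ∀ t, 0 ≤ V t := fun t => by
    have := hsum0 t
    positivity
  have hVM : ∀ t, V t ≤ M * (‖ψ t‖ ^ 2 + ‖b t‖ ^ 2) := by
    intro t
    have h1 : ∑ i, (ψ t i) ^ 2 / L i ≤ (∑ i, 1 / L i) * ‖ψ t‖ ^ 2 := by
      rw [Finset.sum_mul]
      refine Finset.sum_le_sum fun i _ => ?_
      rw [div_eq_inv_mul, one_div]
      refine mul_le_mul_of_nonneg_left ?_ (inv_pos.2 (hL i)).le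
      rw [EuclideanSpace.real_norm_sq_eq]
      exact Finset.single_le_sum (f := fun i => (ψ t i) ^ 2) (fun i _ => sq_nonneg _)
        (Finset.mem_univ i)
    have h2 : 0 ≤ m / 2 * (∑ i, 1 / L i) * ‖b t‖ ^ 2 := by positivity
    have h3 : 0 ≤ kP / 2 * ‖ψ t‖ ^ 2 := by positivity
    have h4 := mul_le_mul_of_nonneg_left h1 (half_pos hm).le
    simp only [hVdef, hMdef]
    linarith
  have hproj : ∀ {f : ℝ → EuclideanSpace ℝ (Fin 3)} {f' : EuclideanSpace ℝ (Fin 3)} {t : ℝ}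
      (_ : HasDerivAt f f' t) (i : Fin 3), HasDerivAt (fun τ => f τ i) (f' i) t :=
    fun h i => (EuclideanSpace.proj (𝕜 := ℝ) i).hasFDerivAt.comp_hasDerivAt _ h
  have hVc : ContinuousOn V (Ici a) := by
    intro t ht
    refine ContinuousAt.continuousWithinAt (ContinuousAt.add (ContinuousAt.const_mul ?_ _)
      (((hb t ht).continuousAt.norm.pow 2).const_mul _))
    refine tendsto_finsetSum _ fun i _ => ?_
    exact (((EuclideanSpace.proj (𝕜 := ℝ) i).continuous.continuousAt.comp (hψc t ht)).pow
      2).div_const _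
  set c₀ : ℝ := min kD (kP * κ) with hc₀
  have hc₀pos : 0 < c₀ := lt_min hkD (mul_pos hkP hκ)
  have hdecay : ∀ t, a ≤ t → 0 < V t → ∀ᶠ s in 𝓝[>] t,
      ∃ d, HasDerivAt V d s ∧
        d ≤ -(c₀ * (1 / M) ^ (1 / p)) * V s ^ (1 / p) := by
    intro t ht hVt
    have hbt : b t ≠ 0 := by
      intro h0
      have : ψ t = 0 := by simp only [hψdef, h0, hv0 t ht h0, psiV_zero]
      simp [hVdef, this, h0] at hVt
    filter_upwards [((hb t ht).continuousAt.eventually_ne hbt).filter_mono nhdsWithin_le_nhds,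
      self_mem_nhdsWithin] with s hbs hts
    have hs : a ≤ s := ht.trans (le_of_lt hts)
    refine ⟨_, ((HasDerivAt.fun_sum fun i (_ : i ∈ Finset.univ) =>
      ((hproj (hψ s hs hbs) i).pow 2).div_const (L i)).const_mul (m / 2)).add
      ((hb s hs).norm_sq.const_mul (kP / 2)), ?_⟩
    have hvs : v s = ψ s - κ • (b s + ‖b s‖ ^ (2 * (1 - p) / p) • b s) := by
      simp only [hψdef, psiV, add_sub_cancel_right]
    have hterm : m / 2 * ∑ i, ((2 : ℕ) * ψ s i ^ (2 - 1) * R s i) / L i =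
        -(kD * (1 + ‖ψ s‖ ^ (2 * (1 - p) / p)) * ‖ψ s‖ ^ 2) - kP * inner ℝ (b s) (ψ s) := by
      rw [EuclideanSpace.real_norm_sq_eq, PiLp.inner_apply]
      simp only [Finset.mul_sum, ← Finset.sum_neg_distrib, ← Finset.sum_sub_distrib]
      refine Finset.sum_congr rfl fun i _ => ?_
      have := (hL i).ne'
      simp only [hRdef, PiLp.smul_apply, PiLp.sub_apply, PiLp.neg_apply, matAct_diagonal_apply,
        PiLp.add_apply, smul_eq_mul]
      simp
      field_simp
    have hinner : inner ℝ (b s) (v s) =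
        inner ℝ (b s) (ψ s) - κ * (1 + ‖b s‖ ^ (2 * (1 - p) / p)) * ‖b s‖ ^ 2 := by
      rw [hvs, inner_sub_right, real_inner_smul_right, inner_add_right, real_inner_smul_right,
        real_inner_self_eq_norm_sq]
      ring
    have hlow : (1 / M) ^ (1 / p) * V s ^ (1 / p) ≤
        (‖ψ s‖ ^ 2) ^ (1 / p) + (‖b s‖ ^ 2) ^ (1 / p) := by
      rw [← Real.mul_rpow (by positivity) (hV0 s)]
      refine le_trans (Real.rpow_le_rpow (mul_nonneg (by positivity) (hV0 s)) ?_ (by positivity))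
        (Real.rpow_add_le_add_rpow (by positivity) (by positivity) (by positivity) ?_)
      · rw [one_div, inv_mul_le_iff₀ hM]
        exact hVM s
      · rw [div_le_one hp0]
        exact hp.1.le
    rw [← norm_rpow_mul_norm_sq hp, ← norm_rpow_mul_norm_sq hp] at hlow
    have hlow' := mul_le_mul_of_nonneg_left hlow hc₀pos.le
    have h1 : c₀ * (‖ψ s‖ ^ (2 * (1 - p) / p) * ‖ψ s‖ ^ 2) ≤
        kD * (‖ψ s‖ ^ (2 * (1 - p) / p) * ‖ψ s‖ ^ 2) :=
      mul_le_mul_of_nonneg_right (min_le_left _ _) (by positivity)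
    have h2 : c₀ * (‖b s‖ ^ (2 * (1 - p) / p) * ‖b s‖ ^ 2) ≤
        kP * κ * (‖b s‖ ^ (2 * (1 - p) / p) * ‖b s‖ ^ 2) :=
      mul_le_mul_of_nonneg_right (min_le_right _ _) (by positivity)
    have h3 : 0 ≤ kD * ‖ψ s‖ ^ 2 := by positivity
    have h4 : 0 ≤ kP * κ * ‖b s‖ ^ 2 := by positivity
    rw [hterm, hinner]
    linarith
  obtain ⟨T, hT, hzero⟩ := exists_eq_zero_of_deriv_le_neg_rpow
    (V := V) (a := a) (γ := 1 / p) (c := c₀ * (1 / M) ^ (1 / p)) (by positivity)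
    (by rw [div_lt_one hp0]; exact hp.1) hVc (fun t _ => hV0 t) hdecay
  refine ⟨T, hT, fun t ht => ?_⟩
  have h1 : kP / 2 * ‖b t‖ ^ 2 = 0 := by
    have h2 : m / 2 * ∑ i, (ψ t i) ^ 2 / L i + kP / 2 * ‖b t‖ ^ 2 = 0 := hzero t ht
    have h3 : 0 ≤ m / 2 * ∑ i, (ψ t i) ^ 2 / L i := mul_nonneg (half_pos hm).le (hsum0 t)
    have h4 : 0 ≤ kP / 2 * ‖b t‖ ^ 2 := by positivity
    linarith
  have h0 : b t = 0 := by simpa [hkP.ne'] using h1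
  exact ⟨h0, hv0 t (hT.trans ht) h0⟩

end Settling

/-- fast finite-time stability of the combined closed-loop
position-tracking error dynamics `(b̃, ṽ)` of the active disturbance rejection
controller together with the translational ESO error dynamics
`(e_b, e_v, e_φ)`, for a rigid body of mass `m` under a constant disturbance
force. -/
theorem translational_adrc_ffts (m p kt1 kt2 kt3 κt κT kTD kTP LT1 LT2 LT3 : ℝ)
    (hm : 0 < m) (hp : p ∈ Set.Ioo (1 : ℝ) 2)
    (h1 : 0 < kt1) (h2 : 0 < kt2) (h3 : 0 < kt3) (hκ : 1 / 2 < κt)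
    (hκT : 0 < κT) (hTD : 0 < kTD) (hTP : 0 < kTP)
    (hL1 : 0 < LT1) (hL2 : 0 < LT2) (hL3 : 0 < LT3)
    (Qt Pt : Matrix (Fin 2) (Fin 2) ℝ) (hQt : Qt.PosDef) (hPt : Pt.PosDef)
    (hLyapEq : (!![-kt1, 1; -kt2, 0] : Matrix (Fin 2) (Fin 2) ℝ)ᵀ * Pt
        + Pt * !![-kt1, 1; -kt2, 0] = -Qt)
    (pm pM qm : ℝ) (hpm : 0 < pm) (hpM : 0 < pM) (hqm : 0 < qm)
    (hPlow : ∀ z : Fin 2 → ℝ, pm * (z 0 ^ 2 + z 1 ^ 2) ≤ z ⬝ᵥ Pt.mulVec z)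
    (hPup : ∀ z : Fin 2 → ℝ, z ⬝ᵥ Pt.mulVec z ≤ pM * (z 0 ^ 2 + z 1 ^ 2))
    (hQlow : ∀ z : Fin 2 → ℝ, qm * (z 0 ^ 2 + z 1 ^ 2) ≤ z ⬝ᵥ Qt.mulVec z)
    (hgain1 : 0 < kt3 * qm / pM - 1 / (kt3 ^ 2 * pm))
    (hgain2 : 0 < kTD * min (min LT1 LT2) LT3 - 1 / 2)
    (hgain3 : 0 <
      min (kt3 * qm / pM - 1 / (kt3 ^ 2 * pm)) (2 * κt - 1) - m ^ 2 / (2 * pm))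
    (eb ev eφ btil vtil : ℝ → EuclideanSpace ℝ (Fin 3))
    (hdb : ∀ t : ℝ, 0 ≤ t → HasDerivAt eb (ev t) t)
    (hdv : ∀ t : ℝ, 0 ≤ t → HasDerivAt ev
      (m⁻¹ • (-(m * kt1) • phi1 p kt3 (psiV p κt (eb t) (ev t))
        - (m * κt) • ((‖eb t‖ ^ (2 * (1 - p) / p)) •
            Hact (eb t) ((p - 1) / p) (ev t) + ev t)
        + eφ t)) t)
    (hdφ : ∀ t : ℝ, 0 ≤ t → HasDerivAt eφ
      (-(m * kt2) • phi2 p kt3 (psiV p κt (eb t) (ev t))) t)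
    (hdbt : ∀ t : ℝ, 0 ≤ t → HasDerivAt btil (vtil t) t)
    (hdvt : ∀ t : ℝ, 0 ≤ t → HasDerivAt vtil
      (m⁻¹ • (eφ t
        - kTD • matAct (Matrix.diagonal ![LT1, LT2, LT3])
            (psiV p κT (btil t) (vtil t) +
              (‖psiV p κT (btil t) (vtil t)‖ ^ (2 * (1 - p) / p)) •
                psiV p κT (btil t) (vtil t))
        - kTP • matAct (Matrix.diagonal ![LT1, LT2, LT3]) (btil t)
        - (m * κT) • (vtil t + (‖btil t‖ ^ (2 * (1 - p) / p)) •
            Hact (btil t) ((p - 1) / p) (vtil t)))) t) :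
    ∃ T : ℝ, 0 ≤ T ∧ ∀ t : ℝ, T ≤ t →
      btil t = 0 ∧ vtil t = 0 ∧ eb t = 0 ∧ ev t = 0 ∧ eφ t = 0 := by
  have hPsymm : Pt 1 0 = Pt 0 1 := by simpa using hPt.isHermitian.apply 0 1
  have hentry := fun i j => congrFun (congrFun hLyapEq i) j
  have h00 := hentry 0 0
  have h01 := hentry 0 1
  have h10 := hentry 1 0
  have h11 := hentry 1 1
  simp [Matrix.mul_apply, Fin.sum_univ_two] at h00 h01 h10 h11
  obtain ⟨T₁, hT₁, hobs⟩ := exists_observer_settling hp h3 (by linarith : 0 < κt) hm hqm hpm hpM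
    (P := Pt) (Q := Qt) (k₁ := kt1) (k₂ := kt2) (by linarith) (by linarith) (by linarith)
    hPlow hPup hQlow hdb hdv hdφ
  obtain ⟨T₂, hT₂, hest⟩ := exists_settling_of_psiV_eq_zero hp (by linarith : 0 < κt)
    (fun t ht => hdb t (hT₁.trans ht)) fun t ht => (hobs t ht).1
  obtain ⟨T₃, hT₃, htrack⟩ := exists_controller_settling (a := T₂) hp hm hκT hTD hTP
    (L := ![LT1, LT2, LT3]) (by simp [Fin.forall_fin_succ, hL1, hL2, hL3])
    (fun t ht => hdbt t ((hT₁.trans hT₂).trans ht)) fun t ht => by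
      simpa only [(hobs t (hT₂.trans ht)).2, zero_sub] using hdvt t ((hT₁.trans hT₂).trans ht)
  refine ⟨T₃, (hT₁.trans hT₂).trans hT₃, fun t ht => ?_⟩
  have ht₂ := hT₃.trans ht
  exact ⟨(htrack t ht).1, (htrack t ht).2, (hest t ht₂).1, (hest t ht₂).2,
    (hobs t (hT₂.trans ht₂)).2⟩
end
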